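/- Let K be a field, S = K[x_1,…,x_n], let I ⊆ S be the ideal generated by the variable x_1 together with a nonempty set E of squarefree monomials of degree 2 in the variables x_2,…,x_n, and let J ⊂ I be a squarefree monomial ideal generated in degrees ≥ 2. Assume sdepth_S I/J = 2, assume x_1·a ∉ J for every a ∈ E, and assume every squarefree monomial u ∈ S of degree 2 with u ∉ I satisfies x_1·u ∈ J. Then depth_S I/J ≤ 2. -/

import Mathlib

open MvPolynomial

/-- The squarefree monomial with support `T` in `K[x_0,…,x_{n-1}]`. -/
noncomputable def sqf (K : Type*) [Field K] (n : ℕ) (T : Finset (Fin n)) :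
    MvPolynomial (Fin n) K :=
  ∏ i ∈ T, X i

/-- The poset `P_{I\J}`: supports of squarefree monomials lying in `I \ J`. -/
def sqfPoset (K : Type*) [Field K] (n : ℕ) (I J : Ideal (MvPolynomial (Fin n) K)) :
    Set (Finset (Fin n)) :=
  {T | sqf K n T ∈ I ∧ sqf K n T ∉ J}

/-- Supports of squarefree monomials of degree `d` lying in `I \ J`. -/
def degSet (K : Type*) [Field K] (n : ℕ) (I J : Ideal (MvPolynomial (Fin n) K)) (d : ℕ) :
    Set (Finset (Fin n)) :=
  {T | T.card = d ∧ T ∈ sqfPoset K n I J}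

/-- A partition of a set `P` of supports of squarefree monomials into intervals
`[u,v] = {w : u ⊆ w ⊆ v}`. -/
structure SqfPartition (n : ℕ) (P : Set (Finset (Fin n))) where
  intervals : Finset (Finset (Fin n) × Finset (Fin n))
  le : ∀ p ∈ intervals, p.1 ⊆ p.2
  ends : ∀ p ∈ intervals, p.1 ∈ P ∧ p.2 ∈ P
  covers : ∀ T ∈ P, ∃ p ∈ intervals, p.1 ⊆ T ∧ T ⊆ p.2
  disj : ∀ p ∈ intervals, ∀ q ∈ intervals, ∀ T : Finset (Fin n),
    p.1 ⊆ T → T ⊆ p.2 → q.1 ⊆ T → T ⊆ q.2 → p = q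

/-- The Stanley depth of a partition: the minimal degree of the upper ends of
its intervals. -/
noncomputable def SqfPartition.sdepth {n : ℕ} {P : Set (Finset (Fin n))}
    (pt : SqfPartition n P) : ℕ :=
  sInf {k | ∃ p ∈ pt.intervals, p.2.card = k}

/-- The Stanley depth of `I/J`: the maximal Stanley depth of a partition of `P_{I\J}`. -/
noncomputable def stanleyDepth (K : Type*) [Field K] (n : ℕ)
    (I J : Ideal (MvPolynomial (Fin n) K)) : ℕ :=
  sSup {k | ∃ pt : SqfPartition n (sqfPoset K n I J), pt.sdepth = k}

/-- The `S`-module `I/J` (for `J ⊆ I` this is the usual quotient). -/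
noncomputable abbrev quotMod (K : Type*) [Field K] (n : ℕ)
    (I J : Ideal (MvPolynomial (Fin n) K)) : Type _ :=
  I ⧸ (Submodule.comap I.subtype J)

/-- The depth of `I/J` over `S = K[x_0,…,x_{n-1}]`: the supremum of lengths of
regular sequences on `I/J` consisting of elements of the maximal graded ideal
`(x_0,…,x_{n-1})`. -/
noncomputable def mdepth (K : Type*) [Field K] (n : ℕ)
    (I J : Ideal (MvPolynomial (Fin n) K)) : ℕ :=
  sSup {k | ∃ rs : List (MvPolynomial (Fin n) K), rs.length = k ∧
    (∀ r ∈ rs, r ∈ Ideal.span (Set.range (X : Fin n → MvPolynomial (Fin n) K))) ∧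
    RingTheory.Sequence.IsRegular (quotMod K n I J) rs}

section Koszul

variable {R M ι : Type*} [CommRing R] [AddCommGroup M] [Module R M] [Fintype ι]
open RingTheory.Sequence

lemma eq_zero_of_forall_smul_eq_zero {x : ι → R} {r : R} (hr : r ∈ Ideal.span (Set.range x))
    (hreg : IsSMulRegular M r) {m : M} (hm : ∀ i, x i • m = 0) : m = 0 := by
  obtain ⟨g, rfl⟩ := Ideal.mem_span_range_iff_exists_fun.1 hr
  apply hreg
  simp [Finset.sum_smul, mul_smul, hm]

lemma exists_smul_eq_of_koszul_one_cocycle {x : ι → R} {r s : R}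
    (hr : r ∈ Ideal.span (Set.range x)) (hs : s ∈ Ideal.span (Set.range x))
    (hreg : IsSMulRegular M r) (hreg' : IsSMulRegular (QuotSMulTop r M) s) {m : ι → M}
    (hm : ∀ i j, x i • m j = x j • m i) : ∃ c : M, ∀ i, m i = x i • c := by
  obtain ⟨g, rfl⟩ := Ideal.mem_span_range_iff_exists_fun.1 hr
  set r := ∑ i, g i * x i with hrdef
  have key : ∀ j, x j • ∑ i, g i • m i = r • m j := by
    intro j
    rw [Finset.smul_sum, hrdef, Finset.sum_smul]
    refine Finset.sum_congr rfl fun i _ => ?_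
    rw [smul_comm, hm j i, mul_smul]
  have h0 : (Submodule.Quotient.mk (∑ i, g i • m i) : QuotSMulTop r M) = 0 := by
    refine eq_zero_of_forall_smul_eq_zero hs hreg' fun j => ?_
    rw [← Submodule.Quotient.mk_smul, key, Submodule.Quotient.mk_eq_zero]
    exact Submodule.smul_mem_pointwise_smul _ _ _ trivial
  rw [Submodule.Quotient.mk_eq_zero] at h0
  obtain ⟨c, -, hc⟩ := h0
  refine ⟨c, fun j => hreg ?_⟩
  change r • m j = r • x j • c
  rw [← key, smul_comm r]
  congr 1
  exact hc.symm

lemma exists_smul_sub_smul_eq_of_koszul_two_cocycle {x : ι → R} {r s t : R}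
    (hr : r ∈ Ideal.span (Set.range x)) (hs : s ∈ Ideal.span (Set.range x))
    (ht : t ∈ Ideal.span (Set.range x)) (hreg : IsWeaklyRegular M [r, s, t]) {m : ι → ι → M}
    (hm : ∀ i j k, x i • m j k - x j • m i k + x k • m i j = 0) :
    ∃ c : ι → M, ∀ i j, m i j = x i • c j - x j • c i := by
  obtain ⟨g, rfl⟩ := Ideal.mem_span_range_iff_exists_fun.1 hr
  set r := ∑ i, g i * x i with hrdef
  simp only [isWeaklyRegular_cons_iff] at hreg
  obtain ⟨hreg, hreg', hreg'', -⟩ := hreg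
  set N : ι → M := fun j => ∑ i, g i • m i j with hN
  have key : ∀ j k, x j • N k - x k • N j = r • m j k := by
    intro j k
    rw [hN, Finset.smul_sum, Finset.smul_sum, hrdef, Finset.sum_smul, ← Finset.sum_sub_distrib]
    refine Finset.sum_congr rfl fun i _ => ?_
    rw [smul_comm (x j), smul_comm (x k), mul_smul, ← smul_sub]
    congr 1
    rw [← sub_eq_zero, ← neg_eq_zero, ← hm i j k]
    abel
  obtain ⟨c, hc⟩ := exists_smul_eq_of_koszul_one_cocycle
    (m := fun j => (Submodule.Quotient.mk (N j) : QuotSMulTop r M)) hs ht hreg' hreg''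
    (fun j k => by
      rw [← sub_eq_zero, ← Submodule.Quotient.mk_smul, ← Submodule.Quotient.mk_smul,
        ← Submodule.Quotient.mk_sub, key, Submodule.Quotient.mk_eq_zero]
      exact Submodule.smul_mem_pointwise_smul _ _ _ trivial)
  obtain ⟨c, rfl⟩ := Submodule.Quotient.mk_surjective _ c
  have h1 : ∀ j, ∃ b : M, r • b = N j - x j • c := by
    intro j
    have := hc j
    rw [← Submodule.Quotient.mk_smul, Submodule.Quotient.eq] at this
    obtain ⟨b, -, hb⟩ := this
    exact ⟨b, hb⟩
  choose b hb using h1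
  refine ⟨b, fun j k => hreg ?_⟩
  change r • m j k = r • (x j • b k - x k • b j)
  rw [← key, smul_sub, smul_comm r, smul_comm r, hb, hb, smul_sub, smul_sub, smul_comm (x k)]
  abel

end Koszul

section LinearIndependence

variable {K W ι : Type*} [Field K] [AddCommGroup W] [Module K W] [Fintype ι] [DecidableEq ι]

lemma LinearIndependent.exists_update_of_mem_span {v : ι → W} (hv : LinearIndependent K v) (j : ι)
    {S : Set W} (hj : v j ∈ Submodule.span K S) :
    ∃ y ∈ S, LinearIndependent K (Function.update v j y) := by
  by_contra! hcon
  have hS : Submodule.span K S ≤ Submodule.span K (v '' {j}ᶜ) := by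
    rw [Submodule.span_le]
    intro y hy
    by_contra hy'
    refine hcon y hy ?_
    rw [Fintype.linearIndependent_iff] at hv ⊢
    intro g hg
    have hsum : ∑ i ∈ Finset.univ.erase j, g i • Function.update v j y i =
        ∑ i ∈ Finset.univ.erase j, g i • v i :=
      Finset.sum_congr rfl fun i hi => by rw [Function.update_of_ne (Finset.ne_of_mem_erase hi)]
    rw [← Finset.add_sum_erase _ _ (Finset.mem_univ j), Function.update_self, hsum] at hg
    have hgj : g j = 0 := by
      by_contra hne
      refine hy' ((Submodule.smul_mem_iff _ hne).1 ?_)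
      rw [eq_neg_of_add_eq_zero_left hg]
      exact neg_mem (sum_mem fun i hi => Submodule.smul_mem _ _
        (Submodule.subset_span ⟨i, by simpa using hi, rfl⟩))
    refine hv g ?_
    rw [← Finset.add_sum_erase _ _ (Finset.mem_univ j), hgj, zero_smul]
    simpa [hgj] using hg
  exact (linearIndependent_iff_notMem_span.1 hv j) (by simpa [Set.compl_eq_univ_sdiff] using hS hj)

lemma LinearIndependent.exists_of_forall_mem_span {v : ι → W} (hv : LinearIndependent K v)
    {S : ι → Set W} (hS : ∀ i, v i ∈ Submodule.span K (S i)) :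
    ∃ h : ι → W, (∀ i, h i ∈ S i) ∧ LinearIndependent K h := by
  suffices H : ∀ s : Finset ι, ∃ h : ι → W, (∀ i ∈ s, h i ∈ S i) ∧ (∀ i ∉ s, h i = v i) ∧
      LinearIndependent K h by
    obtain ⟨h, h1, -, h2⟩ := H Finset.univ
    exact ⟨h, fun i => h1 i (Finset.mem_univ i), h2⟩
  intro s
  induction s using Finset.induction_on with
  | empty => exact ⟨v, by simp, by simp, hv⟩
  | insert j s hj ih =>
    obtain ⟨h, h1, h2, h3⟩ := ih
    obtain ⟨y, hy, hind⟩ := h3.exists_update_of_mem_span j (by rw [h2 j hj]; exact hS j)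
    refine ⟨_, fun i hi => ?_, fun i hi => ?_, hind⟩
    · rcases eq_or_ne i j with rfl | hij
      · simpa using hy
      · rw [Function.update_of_ne hij]
        exact h1 i (Finset.mem_of_mem_insert_of_ne hi hij)
    · rw [Finset.mem_insert, not_or] at hi
      rw [Function.update_of_ne hi.1, h2 i hi.2]

lemma LinearIndependent.exists_sub_of_not_linearIndependent {v v' : ι → W}
    (hv : LinearIndependent K v) (hv' : ¬ LinearIndependent K v') :
    ∃ (j : ι) (h : ι → W), LinearIndependent K h ∧ h j = v j - v' j ∧
      ∀ i ≠ j, h i = v i ∨ h i = v' i := by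
  by_contra! hcon
  suffices H : ∀ s : Finset ι, LinearIndependent K (s.piecewise v' v) by
    exact hv' (by simpa using H Finset.univ)
  intro s
  induction s using Finset.induction_on with
  | empty => simpa using hv
  | insert j s hj ih =>
    obtain ⟨y, hy, hind⟩ := ih.exists_update_of_mem_span j (S := {v' j, v j - v' j}) (by
      rw [Finset.piecewise_eq_of_notMem _ _ _ hj, ← add_sub_cancel (v' j) (v j)]
      exact add_mem (Submodule.subset_span (by simp)) (Submodule.subset_span (by simp)))
    rcases hy with rfl | rfl
    · rwa [Finset.piecewise_insert]
    · obtain ⟨i, hi, h1, h2⟩ := hcon j _ hind (by simp)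
      rw [Function.update_of_ne hi] at h1 h2
      by_cases his : i ∈ s <;> simp [his] at h1 h2

end LinearIndependence

section Cochains

variable (K : Type*) [Field K] {α : Type*} [LinearOrder α]

open Classical in
/-- The simplicial coboundary from vertices to edges, with values restricted to the edges in `E`. -/
noncomputable def edgeCoboundary (E : Set (Finset α)) : (α → K) →ₗ[K] (α × α → K) where
  toFun w p := if p.1 < p.2 ∧ {p.1, p.2} ∈ E then w p.2 - w p.1 else 0
  map_add' w w' := by
    ext p
    by_cases h : p.1 < p.2 ∧ {p.1, p.2} ∈ E
    · simp [h]; ring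
    · simp [h]
  map_smul' c w := by
    ext p
    by_cases h : p.1 < p.2 ∧ {p.1, p.2} ∈ E
    · simp [h]; ring
    · simp [h]

open Classical in
/-- The simplicial coboundary from edges to triangles, with values restricted to the triangles
in `C`. -/
noncomputable def triangleCoboundary (C : Set (Finset α)) :
    (α × α → K) →ₗ[K] (α × α × α → K) where
  toFun z t := if t.1 < t.2.1 ∧ t.2.1 < t.2.2 ∧ {t.1, t.2.1, t.2.2} ∈ C then
    z (t.2.1, t.2.2) - z (t.1, t.2.2) + z (t.1, t.2.1) else 0
  map_add' w w' := by
    ext p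
    by_cases h : p.1 < p.2.1 ∧ p.2.1 < p.2.2 ∧ {p.1, p.2.1, p.2.2} ∈ C
    · simp [h]; ring
    · simp [h]
  map_smul' c w := by
    ext p
    by_cases h : p.1 < p.2.1 ∧ p.2.1 < p.2.2 ∧ {p.1, p.2.1, p.2.2} ∈ C
    · simp [h]; ring
    · simp [h]

variable {K}

lemma edgeCoboundary_single_ne_zero {E : Set (Finset α)} {k : α} {p : α × α}
    (h : edgeCoboundary K E (Pi.single k 1) p ≠ 0) :
    p.1 < p.2 ∧ {p.1, p.2} ∈ E ∧ (k = p.1 ∨ k = p.2) := by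
  classical
  simp only [edgeCoboundary, LinearMap.coe_mk, AddHom.coe_mk, ne_eq, ite_eq_right_iff,
    Classical.not_imp] at h
  obtain ⟨⟨h1, h2⟩, h3⟩ := h
  refine ⟨h1, h2, ?_⟩
  by_contra! hk
  exact h3 (by simp [Pi.single_eq_of_ne hk.1.symm, Pi.single_eq_of_ne hk.2.symm])

lemma triangleCoboundary_single_ne_zero {C : Set (Finset α)} {p : α × α} {t : α × α × α}
    (h : triangleCoboundary K C (Pi.single p 1) t ≠ 0) :
    t.1 < t.2.1 ∧ t.2.1 < t.2.2 ∧ {t.1, t.2.1, t.2.2} ∈ C ∧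
      ({p.1, p.2} : Finset α) ⊆ {t.1, t.2.1, t.2.2} := by
  classical
  simp only [triangleCoboundary, LinearMap.coe_mk, AddHom.coe_mk, ne_eq, ite_eq_right_iff,
    Classical.not_imp] at h
  obtain ⟨⟨h1, h2, h4⟩, h3⟩ := h
  refine ⟨h1, h2, h4, ?_⟩
  by_contra hk
  refine h3 ?_
  have e1 : (t.2.1, t.2.2) ≠ p := by rintro rfl; simp at hk
  have e2 : (t.1, t.2.2) ≠ p := by
    rintro rfl; apply hk; simp [Finset.insert_subset_iff]
  have e3 : (t.1, t.2.1) ≠ p := by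
    rintro rfl; apply hk; simp [Finset.insert_subset_iff]
  simp [Pi.single_eq_of_ne e1, Pi.single_eq_of_ne e2, Pi.single_eq_of_ne e3]

lemma map_mem_span_single {β W : Type*} [Fintype β] [DecidableEq β] [AddCommGroup W] [Module K W]
    (L : (β → K) →ₗ[K] W) (z : β → K) {s : Set β} (hs : ∀ p, z p ≠ 0 → p ∈ s) :
    L z ∈ Submodule.span K ((fun p => L (Pi.single p 1)) '' s) := by
  have hz : z = ∑ p, z p • Pi.single p (1 : K) := by
    ext q
    simp [Finset.sum_apply, Pi.single_apply]
  rw [hz, map_sum]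
  refine sum_mem fun p _ => ?_
  rw [map_smul]
  by_cases h : z p = 0
  · simp [h]
  · exact Submodule.smul_mem _ _ (Submodule.subset_span ⟨p, hs p h, rfl⟩)

lemma mem_span_single {β : Type*} [Fintype β] [DecidableEq β] (z : β → K) {s : Set β}
    (hs : ∀ p, z p ≠ 0 → p ∈ s) :
    z ∈ Submodule.span K ((fun p => (Pi.single p (1 : K) : β → K)) '' s) := by
  simpa only [LinearMap.id_apply] using
    map_mem_span_single (LinearMap.id (R := K) (M := β → K)) z hs

lemma edgeCoboundary_avoiding (E : Set (Finset α)) (i : α) (w : α → K) (p : α × α) :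
    edgeCoboundary K {a | a ∈ E ∧ i ∉ a} w p =
      if i ∈ ({p.1, p.2} : Finset α) then 0 else edgeCoboundary K E w p := by
  by_cases hi : i ∈ ({p.1, p.2} : Finset α)
  · rw [if_pos hi]
    exact if_neg fun h => h.2.2 hi
  · rw [if_neg hi]
    by_cases h : p.1 < p.2 ∧ ({p.1, p.2} : Finset α) ∈ E
    · exact (if_pos ⟨h.1, h.2, hi⟩).trans (if_pos h).symm
    · exact (if_neg fun h' => h ⟨h'.1, h'.2.1⟩).trans (if_neg h).symm

lemma pair_injective_of_lt {a b c d : α} (hab : a < b) (hcd : c < d)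
    (h : ({a, b} : Finset α) = {c, d}) : (a, b) = (c, d) := by
  simp only [Finset.ext_iff, Finset.mem_insert, Finset.mem_singleton] at h
  have ha := h a
  have hb := h b
  have hc := h c
  have hd := h d
  grind

lemma triple_injective_of_lt {a b c a' b' c' : α} (hab : a < b) (hbc : b < c) (hab' : a' < b')
    (hbc' : b' < c') (h : ({a, b, c} : Finset α) = {a', b', c'}) : (a, b, c) = (a', b', c') := by
  simp only [Finset.ext_iff, Finset.mem_insert, Finset.mem_singleton] at h
  have h1 := h a
  have h2 := h b
  have h3 := h c
  have h4 := h a'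
  have h5 := h b'
  have h6 := h c'
  grind

lemma exists_matching_of_coboundary_injective [Fintype α] {V : Set α} {E C : Set (Finset α)}
    {i : α} (hEV : ∀ a ∈ E, ∀ k ∈ a, k ∈ V) (hne : ∃ k ∈ V, k ≠ i)
    (hker : ∀ w : α → K, (∀ k, k ∉ V → w k = 0) → w i = 0 →
      triangleCoboundary K C (edgeCoboundary K E w) = 0 → w = 0) :
    ∃ (j : {k // k ∈ V ∧ k ≠ i}) (f t : {k // k ∈ V ∧ k ≠ i} → Finset α),
      Function.Injective f ∧ Function.Injective t ∧ f j = {i, ↑j} ∧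
      ∀ k, f k ∈ E ∧ ↑k ∈ f k ∧ t k ∈ C ∧ f k ⊆ t k := by
  classical
  set L := triangleCoboundary K C
  set E' : Set (Finset α) := {a | a ∈ E ∧ i ∉ a} with hE'
  set u : {k // k ∈ V ∧ k ≠ i} → (α × α × α → K) :=
    fun k => L (edgeCoboundary K E (Pi.single ↑k 1)) with hu
  set u' : {k // k ∈ V ∧ k ≠ i} → (α × α × α → K) :=
    fun k => L (edgeCoboundary K E' (Pi.single ↑k 1)) with hu'
  have hext : ∀ g : {k // k ∈ V ∧ k ≠ i} → K, ∀ x : α,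
      (∑ k, g k • (Pi.single (k : α) (1 : K) : α → K)) x =
        if h : x ∈ V ∧ x ≠ i then g ⟨x, h⟩ else 0 := by
    intro g x
    rw [Finset.sum_apply]
    split_ifs with h
    · rw [Finset.sum_eq_single ⟨x, h⟩]
      · simp
      · intro b _ hb
        have : x ≠ b := fun hx => hb (Subtype.ext hx.symm)
        simp [Pi.single_eq_of_ne this]
      · simp
    · refine Finset.sum_eq_zero fun b _ => ?_
      have : x ≠ b := by
        rintro rfl
        exact h b.2
      simp [Pi.single_eq_of_ne this]
  have hind : LinearIndependent K u := by
    rw [Fintype.linearIndependent_iff]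
    intro g hg k
    have := hker (∑ k, g k • (Pi.single (k : α) (1 : K) : α → K))
      (fun x hx => by rw [hext, dif_neg fun h => hx h.1])
      (by rw [hext, dif_neg fun h => h.2 rfl])
      (by rw [map_sum, map_sum]; simpa [hu] using hg)
    have h2 := congrFun this k
    rw [hext, dif_pos k.2] at h2
    exact h2
  have hdep : ¬ LinearIndependent K u' := by
    rw [Fintype.not_linearIndependent_iff]
    obtain ⟨k, hk⟩ := hne
    refine ⟨fun _ => 1, ?_, ⟨k, hk⟩, one_ne_zero⟩
    have h0 : edgeCoboundary K E' (∑ k : {k // k ∈ V ∧ k ≠ i},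
        (1 : K) • (Pi.single (k : α) (1 : K) : α → K)) = 0 := by
      ext p
      simp only [edgeCoboundary, LinearMap.coe_mk, AddHom.coe_mk, Pi.zero_apply,
        ite_eq_right_iff]
      rintro ⟨-, hE, hi⟩
      rw [hext, hext, dif_pos, dif_pos, sub_self]
      · exact ⟨hEV _ hE _ (by simp), by rintro h; simp [h] at hi⟩
      · exact ⟨hEV _ hE _ (by simp), by rintro h; simp [h] at hi⟩
    have := congrArg L h0
    simpa only [map_sum, map_smul, map_zero] using this
  obtain ⟨j, h, hh, hj, hother⟩ := hind.exists_sub_of_not_linearIndependent hdep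
  obtain ⟨h', hmem, hind'⟩ := hh.exists_of_forall_mem_span
    (S := fun k => (fun p => L (Pi.single p 1)) '' {p | p.1 < p.2 ∧ {p.1, p.2} ∈ E ∧
      (↑k = p.1 ∨ ↑k = p.2) ∧ (k = j → ({p.1, p.2} : Finset α) = {i, ↑j})}) (by
    intro k
    rcases eq_or_ne k j with rfl | hkj
    · rw [hj, hu, hu', ← map_sub]
      refine map_mem_span_single L _ fun p hp => ?_
      rw [Pi.sub_apply, hE', edgeCoboundary_avoiding] at hp
      split_ifs at hp with hi
      swap
      · exact absurd (sub_self _) hp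
      rw [sub_zero] at hp
      obtain ⟨h1, h2, h3⟩ := edgeCoboundary_single_ne_zero hp
      refine ⟨h1, h2, h3, fun _ => ?_⟩
      have := k.2.2
      simp only [Finset.mem_insert, Finset.mem_singleton] at hi
      rcases h3 with h3 | h3 <;> rcases hi with hi | hi
      · exact absurd (h3.trans hi.symm) this
      · rw [h3, hi, Finset.pair_comm]
      · rw [h3, hi]
      · exact absurd (h3.trans hi.symm) this
    · rcases hother k hkj with e | e <;> rw [e]
      · refine map_mem_span_single L _ fun p hp => ?_
        obtain ⟨h1, h2, h3⟩ := edgeCoboundary_single_ne_zero hp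
        exact ⟨h1, h2, h3, fun h => absurd h hkj⟩
      · refine map_mem_span_single L _ fun p hp => ?_
        obtain ⟨h1, h2, h3⟩ := edgeCoboundary_single_ne_zero hp
        exact ⟨h1, h2.1, h3, fun h => absurd h hkj⟩)
  choose p hp hpe using hmem
  obtain ⟨h'', hmem', hind''⟩ := hind'.exists_of_forall_mem_span
    (S := fun k => (fun t => (Pi.single t (1 : K) : α × α × α → K)) ''
      {t | t.1 < t.2.1 ∧ t.2.1 < t.2.2 ∧ {t.1, t.2.1, t.2.2} ∈ C ∧
      ({(p k).1, (p k).2} : Finset α) ⊆ {t.1, t.2.1, t.2.2}}) (by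
    intro k
    refine mem_span_single _ fun t ht => ?_
    rw [← hpe k] at ht
    exact triangleCoboundary_single_ne_zero ht)
  choose t ht hte using hmem'
  refine ⟨j, fun k => {(p k).1, (p k).2}, fun k => {(t k).1, (t k).2.1, (t k).2.2}, ?_, ?_,
    (hp j).2.2.2 rfl, fun k => ⟨(hp k).2.1, ?_, (ht k).2.2.1, (ht k).2.2.2⟩⟩
  · intro k l hkl
    refine hind'.injective ?_
    rw [← hpe, ← hpe, show p k = p l from pair_injective_of_lt (hp k).1 (hp l).1 hkl]
  · intro k l hkl
    refine hind''.injective ?_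
    rw [← hte, ← hte, show t k = t l from triple_injective_of_lt (ht k).1 (ht k).2.1 (ht l).1
      (ht l).2.1 hkl]
  · simpa using (hp k).2.2.1

end Cochains

/-- The exponent vector of the squarefree monomial with support `T`. -/
noncomputable def sqfExp {n : ℕ} (T : Finset (Fin n)) : Fin n →₀ ℕ :=
  ∑ i ∈ T, Finsupp.single i 1

lemma sqfExp_apply {n : ℕ} (T : Finset (Fin n)) (i : Fin n) :
    sqfExp T i = if i ∈ T then 1 else 0 := by
  simp [sqfExp, Finsupp.finsetSum_apply, Finsupp.single_apply]

lemma sqfExp_le_iff {n : ℕ} {T U : Finset (Fin n)} : sqfExp T ≤ sqfExp U ↔ T ⊆ U := by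
  refine ⟨fun h i hi => ?_, fun h i => ?_⟩
  · by_contra hU
    simpa [sqfExp_apply, hi, hU] using h i
  · by_cases hi : i ∈ T
    · simp [sqfExp_apply, hi, h hi]
    · simp [sqfExp_apply, hi]

section SquarefreeMonomials

variable (K : Type*) [Field K] {n : ℕ}

lemma sqf_eq_monomial (T : Finset (Fin n)) : sqf K n T = monomial (sqfExp T) 1 := by
  simp [sqf, sqfExp, X, MvPolynomial.monomial_sum_one]

lemma mem_span_sqf_iff {G : Set (Finset (Fin n))} {p : MvPolynomial (Fin n) K} :
    p ∈ Ideal.span (sqf K n '' G) ↔ ∀ m ∈ p.support, ∃ T ∈ G, sqfExp T ≤ m := by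
  have h : sqf K n '' G = (fun s => (monomial s) (1 : K)) '' (sqfExp '' G) := by
    rw [Set.image_image]
    exact Set.image_congr fun T _ => sqf_eq_monomial K T
  rw [h, mem_ideal_span_monomial_image]
  simp

lemma sqf_mem_span_sqf_iff {G : Set (Finset (Fin n))} {U : Finset (Fin n)} :
    sqf K n U ∈ Ideal.span (sqf K n '' G) ↔ ∃ T ∈ G, T ⊆ U := by
  classical
  rw [mem_span_sqf_iff, sqf_eq_monomial, support_monomial]
  simp [sqfExp_le_iff]

lemma X_mul_sqf {i : Fin n} {T : Finset (Fin n)} (hi : i ∉ T) :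
    X i * sqf K n T = sqf K n (insert i T) := by
  simp [sqf, Finset.prod_insert hi]

lemma X_eq_sqf (i : Fin n) : (X i : MvPolynomial (Fin n) K) = sqf K n {i} := by
  simp [sqf]

end SquarefreeMonomials

lemma exists_sqfPartition_of_matching {n : ℕ} {P : Set (Finset (Fin n))} {o i j : Fin n}
    (hoi : o ≠ i) (hoj : o ≠ j) (hij : i ≠ j)
    (hP : ∀ T ∈ P, T = {o} ∨ 2 ≤ T.card) (ho : {o} ∈ P) (hoij : {o, i, j} ∈ P)
    (Φ : Finset (Fin n) → Finset (Fin n))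
    (hΦ : ∀ T ∈ P, T.card = 2 → T ≠ {o, i} → T ≠ {o, j} →
      T ⊆ Φ T ∧ (Φ T).card = 3 ∧ Φ T ∈ P ∧ Φ T ≠ {o, i, j})
    (hinj : ∀ T ∈ P, T.card = 2 → T ≠ {o, i} → T ≠ {o, j} →
      ∀ U ∈ P, U.card = 2 → U ≠ {o, i} → U ≠ {o, j} → Φ T = Φ U → T = U) :
    ∃ pt : SqfPartition n P, ∀ p ∈ pt.intervals, 3 ≤ p.2.card := by
  classical
  set B : Set (Finset (Fin n)) := {T | T ∈ P ∧ T.card = 2 ∧ T ≠ {o, i} ∧ T ≠ {o, j}} with hB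
  have hΦB : ∀ T ∈ B, T ⊆ Φ T ∧ (Φ T).card = 3 ∧ Φ T ∈ P ∧ Φ T ≠ {o, i, j} :=
    fun T hT => hΦ T hT.1 hT.2.1 hT.2.2.1 hT.2.2.2
  have hinjB : ∀ T ∈ B, ∀ U ∈ B, Φ T = Φ U → T = U :=
    fun T hT U hU => hinj T hT.1 hT.2.1 hT.2.2.1 hT.2.2.2 U hU.1 hU.2.1 hU.2.2.1 hU.2.2.2
  have h3 : ({o, i, j} : Finset (Fin n)).card = 3 := Finset.card_eq_three.2
    ⟨o, i, j, hoi, hoj, hij, rfl⟩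
  have hoi2 : ({o, i} : Finset (Fin n)).card = 2 := Finset.card_pair hoi
  have hoj2 : ({o, j} : Finset (Fin n)).card = 2 := Finset.card_pair hoj
  set s : Set (Finset (Fin n) × Finset (Fin n)) := {p | p = ({o}, {o, i, j}) ∨
    (p.1 ∈ B ∧ p.2 = Φ p.1) ∨
    (p.1 ∈ P ∧ p.2 = p.1 ∧ 3 ≤ p.1.card ∧ p.1 ≠ {o, i, j} ∧ ∀ T ∈ B, Φ T ≠ p.1)} with hs
  have hmem : ∀ p, p ∈ s.toFinset ↔ p ∈ s := fun p => Set.mem_toFinset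
  have hmid : ∀ T : Finset (Fin n), {o} ⊆ T → T ⊆ {o, i, j} →
      T = {o} ∨ T = {o, i} ∨ T = {o, j} ∨ T = {o, i, j} := by
    intro T h1 h2
    have hoT : o ∈ T := h1 (by simp)
    by_cases hi : i ∈ T <;> by_cases hj : j ∈ T
    · right; right; right
      ext x; have := @h2 x; simp at this ⊢; grind
    · right; left
      ext x; have := @h2 x; simp at this ⊢; grind
    · right; right; left
      ext x; have := @h2 x; simp at this ⊢; grind
    · left
      ext x; have := @h2 x; simp at this ⊢; grind
  have hclass : ∀ p ∈ s, ∀ T, p.1 ⊆ T → T ⊆ p.2 →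
      (p = ({o}, {o, i, j}) ∧ (T = {o} ∨ T = {o, i} ∨ T = {o, j} ∨ T = {o, i, j})) ∨
      (p.1 ∈ B ∧ p.2 = Φ p.1 ∧ (T = p.1 ∨ T = Φ p.1)) ∨
      (p = (T, T) ∧ 3 ≤ T.card ∧ T ≠ {o, i, j} ∧ ∀ U ∈ B, Φ U ≠ T) := by
    rintro ⟨u, v⟩ (h | ⟨h, h'⟩ | ⟨h, h', h4, h5, h6⟩) T h1 h2
    · rw [h] at h1 h2
      exact Or.inl ⟨h, hmid T h1 h2⟩
    · dsimp only at h h' h1 h2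
      subst h'
      refine Or.inr (Or.inl ⟨h, rfl, ?_⟩)
      have h4 : (Φ u).card = 3 := (hΦB u h).2.1
      dsimp only at h1 h2 ⊢
      have h5 := h.2.1
      rcases Nat.lt_or_ge T.card 3 with h6 | h6
      · exact Or.inl (Finset.eq_of_subset_of_card_le h1 (by omega)).symm
      · exact Or.inr (Finset.eq_of_subset_of_card_le h2 (by omega))
    · dsimp only at h h' h1 h2 h4 h5 h6
      subst h'
      obtain rfl := h1.antisymm h2
      exact Or.inr (Or.inr ⟨rfl, h4, h5, h6⟩)
  refine ⟨⟨s.toFinset, fun p hp => ?_, fun p hp => ?_, fun T hT => ?_,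
    fun p hp q hq T hp1 hp2 hq1 hq2 => ?_⟩, fun p hp => ?_⟩
  · rcases (hmem p).1 hp with h | ⟨h, h'⟩ | ⟨h, h', -⟩
    · simp [h]
    · rw [h']; exact (hΦB _ h).1
    · rw [h']
  · rcases (hmem p).1 hp with h | ⟨h, h'⟩ | ⟨h, h', -⟩
    · simp [h, ho, hoij]
    · rw [h']; exact ⟨h.1, (hΦB _ h).2.2.1⟩
    · rw [h']; exact ⟨h, h⟩
  · by_cases hsub : {o} ⊆ T ∧ T ⊆ {o, i, j}
    · exact ⟨_, (hmem ({o}, {o, i, j})).2 (Or.inl rfl), hsub⟩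
    by_cases hTB : T ∈ B
    · exact ⟨_, (hmem (T, Φ T)).2 (Or.inr (Or.inl ⟨hTB, rfl⟩)), subset_rfl, (hΦB T hTB).1⟩
    by_cases hTΦ : ∃ U ∈ B, Φ U = T
    · obtain ⟨U, hU, rfl⟩ := hTΦ
      exact ⟨_, (hmem (U, Φ U)).2 (Or.inr (Or.inl ⟨hU, rfl⟩)), (hΦB U hU).1, subset_rfl⟩
    push Not at hTΦ
    refine ⟨_, (hmem (T, T)).2 (Or.inr (Or.inr ⟨hT, rfl, ?_, ?_, hTΦ⟩)), subset_rfl, subset_rfl⟩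
    · have h2 : 2 ≤ T.card := by
        rcases hP T hT with rfl | h
        · exact absurd ⟨subset_rfl, by simp⟩ hsub
        · exact h
      have : T.card ≠ 2 := by
        intro h
        refine hTB ⟨hT, h, ?_, ?_⟩ <;> rintro rfl <;> apply hsub <;> simp [Finset.insert_subset_iff]
      dsimp only
      omega
    · rintro rfl
      exact hsub (by simp)
  · have hp' := hclass p ((hmem p).1 hp) T hp1 hp2
    have hq' := hclass q ((hmem q).1 hq) T hq1 hq2
    have hnot : ∀ U ∈ B, (T = U ∨ T = Φ U) →
        ¬ (T = {o} ∨ T = {o, i} ∨ T = {o, j} ∨ T = {o, i, j}) := by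
      rintro U hU (rfl | rfl)
      · rintro (h | h | h | h)
        · simpa [h] using hU.2.1
        · exact hU.2.2.1 h
        · exact hU.2.2.2 h
        · have := hU.2.1
          rw [h] at this
          omega
      · obtain ⟨-, h4, -, h5⟩ := hΦB U hU
        rintro (h | h | h | h)
        · simp [h] at h4
        · rw [h] at h4; omega
        · rw [h] at h4; omega
        · exact h5 h
    have hnot' : 3 ≤ T.card → T ≠ {o, i, j} →
        ¬ (T = {o} ∨ T = {o, i} ∨ T = {o, j} ∨ T = {o, i, j}) := by
      rintro h h' (rfl | rfl | rfl | rfl)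
      · simp at h
      · omega
      · omega
      · exact h' rfl
    have hnotB : ∀ U ∈ B, (T = U ∨ T = Φ U) → 3 ≤ T.card → ¬ ∀ U ∈ B, Φ U ≠ T := by
      rintro U hU (rfl | rfl) h h'
      · have := hU.2.1
        omega
      · exact h' U hU rfl
    rcases hp' with ⟨ep, hp'⟩ | ⟨hpB, ep, hp'⟩ | ⟨ep, hp3, hpn, hpΦ⟩ <;>
      rcases hq' with ⟨eq, hq'⟩ | ⟨hqB, eq, hq'⟩ | ⟨eq, hq3, hqn, hqΦ⟩
    · rw [ep, eq]
    · exact absurd hp' (hnot _ hqB hq')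
    · exact absurd hp' (hnot' hq3 hqn)
    · exact absurd hq' (hnot _ hpB hp')
    · have : p.1 = q.1 := by
        have hp2 := hpB.2.1
        have hq2 := hqB.2.1
        have hp3 := (hΦB _ hpB).2.1
        have hq3 := (hΦB _ hqB).2.1
        rcases hp' with h | h <;> rcases hq' with h' | h'
        · exact h.symm.trans h'
        · rw [h] at h'; rw [h'] at hp2; omega
        · rw [h] at h'; rw [h'] at hp3; omega
        · exact hinjB _ hpB _ hqB (h.symm.trans h')
      exact Prod.ext this (by rw [ep, eq, this])
    · exact absurd hqΦ (hnotB _ hpB hp' hq3)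
    · exact absurd hq' (hnot' hp3 hpn)
    · exact absurd hpΦ (hnotB _ hqB hq' hp3)
    · rw [ep, eq]
  · rcases (hmem p).1 hp with h | ⟨h, h'⟩ | ⟨h, h', h4, -⟩
    · simp [h, h3]
    · rw [h', (hΦB _ h).2.1]
    · rwa [h']

lemma coeff_single_eq_zero_of_mem {n : ℕ} [NeZero n] {K : Type*} [Field K]
    {E : Set (Finset (Fin n))} (hE : ∀ T ∈ E, T.card = 2 ∧ (0 : Fin n) ∉ T)
    {p : MvPolynomial (Fin n) K} (hp : p ∈ Ideal.span (sqf K n '' insert {0} E)) {k : Fin n}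
    (hk : k ≠ 0) : coeff (Finsupp.single k 1) p = 0 := by
  by_contra h
  obtain ⟨T, hT, hle⟩ := (mem_span_sqf_iff K).1 hp _ (mem_support_iff.2 h)
  have hsub : T ⊆ {k} := by
    intro x hx
    have := hle x
    simp only [sqfExp_apply, hx, if_true, Finsupp.single_apply] at this
    by_contra hxk
    rw [if_neg fun h => hxk (by simp [h])] at this
    omega
  rcases hT with rfl | hT
  · exact hk (Finset.mem_singleton.1 (hsub (Finset.mem_singleton_self 0))).symm
  · have := Finset.card_le_card hsub
    rw [(hE T hT).1, Finset.card_singleton] at this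
    omega

lemma eq_zero_of_isWeaklyRegular {n : ℕ} [NeZero n] {K : Type*} [Field K]
    {I J : Ideal (MvPolynomial (Fin n) K)} {E G : Set (Finset (Fin n))}
    (hE : ∀ T ∈ E, T.card = 2 ∧ (0 : Fin n) ∉ T)
    (hI : I = Ideal.span (sqf K n '' insert {0} E)) (hJ : J = Ideal.span (sqf K n '' G))
    (hout : ∀ T : Finset (Fin n), T.card = 2 → sqf K n T ∉ I → X (0 : Fin n) * sqf K n T ∈ J)
    {r s t : MvPolynomial (Fin n) K} (hr : r ∈ Ideal.span (Set.range X))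
    (hs : s ∈ Ideal.span (Set.range X)) (ht : t ∈ Ideal.span (Set.range X))
    (hreg : RingTheory.Sequence.IsWeaklyRegular (quotMod K n I J) [r, s, t])
    {w : Fin n → K} (hw0 : w 0 = 0) {i : Fin n} (hi0 : i ≠ 0) (hi : sqf K n {0, i} ∉ J)
    (hwi : w i = 0)
    (hker : triangleCoboundary K {c | 0 ∉ c ∧ c ∈ sqfPoset K n I J ∧ c.card = 3} (edgeCoboundary K E w) = 0)
    {k : Fin n} (hk0 : k ≠ 0) (hk : sqf K n {0, k} ∉ J) : w k = 0 := by
  classical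
  set D : Fin n → Fin n → K := fun a b =>
    if a = 0 ∨ b = 0 ∨ ({a, b} : Finset (Fin n)) ∈ E then w b - w a else 0 with hD
  have hDanti : ∀ a b, D a b = - D b a := by
    intro a b
    by_cases h : a = 0 ∨ b = 0 ∨ ({a, b} : Finset (Fin n)) ∈ E
    · have h' : b = 0 ∨ a = 0 ∨ ({b, a} : Finset (Fin n)) ∈ E := by
        rw [Finset.pair_comm b a]; tauto
      simp [hD, h, h']
    · have h' : ¬ (b = 0 ∨ a = 0 ∨ ({b, a} : Finset (Fin n)) ∈ E) := by
        rw [Finset.pair_comm b a]; tauto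
      simp only [hD, if_neg h, if_neg h', neg_zero]
  have hDself : ∀ a, D a a = 0 := fun a => by simp [hD]
  have hE_mem : ∀ {a b : Fin n}, a ≠ b → a ≠ 0 → b ≠ 0 →
      (sqf K n {a, b} ∈ I ↔ ({a, b} : Finset (Fin n)) ∈ E) := by
    intro a b hab ha hb
    rw [hI, sqf_mem_span_sqf_iff]
    constructor
    · rintro ⟨T, rfl | hT, hsub⟩
      · simp [Finset.singleton_subset_iff, ha.symm, hb.symm] at hsub
      · rwa [← Finset.eq_of_subset_of_card_le hsub
          (by rw [(hE T hT).1, Finset.card_pair hab])]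
    · exact fun h => ⟨_, Or.inr h, subset_rfl⟩
  have hsorted : ∀ a b c, a < b → b < c →
      D b c - D a c + D a b = 0 ∨ sqf K n {a, b, c} ∈ J := by
    intro a b c hab hbc
    have hb : b ≠ 0 := ((Fin.zero_le a).trans_lt hab).ne'
    have hc : c ≠ 0 := ((Fin.zero_le b).trans_lt hbc).ne'
    by_cases ha : a = 0
    · subst ha
      by_cases h : ({b, c} : Finset (Fin n)) ∈ E
      · left; simp [hD, h, hw0]
      · right
        have := hout {b, c} (Finset.card_pair hbc.ne) fun h' => h ((hE_mem hbc.ne hb hc).1 h')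
        rwa [X_mul_sqf K (by simp [hb.symm, hc.symm])] at this
    · by_cases hJ' : sqf K n {a, b, c} ∈ J
      · exact Or.inr hJ'
      left
      have hDe : ∀ {x y}, x < y → x ≠ 0 → y ≠ 0 → D x y = edgeCoboundary K E w (x, y) := by
        intro x y hxy hx hy
        simp only [hD, edgeCoboundary, LinearMap.coe_mk, AddHom.coe_mk, hx, hy, hxy, false_or,
          true_and]
      by_cases hI' : sqf K n {a, b, c} ∈ I
      · have := congrFun hker (a, b, c)
        simp only [triangleCoboundary, LinearMap.coe_mk, AddHom.coe_mk, Pi.zero_apply] at this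
        rw [if_pos ⟨hab, hbc, by simp [Ne.symm ha, hb.symm, hc.symm], ⟨hI', hJ'⟩,
          Finset.card_eq_three.2 ⟨a, b, c, hab.ne, (hab.trans hbc).ne, hbc.ne, rfl⟩⟩] at this
        rw [hDe hab ha hb, hDe hbc hb hc, hDe (hab.trans hbc) ha hc, this]
      · have hno : ∀ x y, x ∈ ({a, b, c} : Finset (Fin n)) → y ∈ ({a, b, c} : Finset (Fin n)) →
            x ≠ 0 → y ≠ 0 → D x y = 0 := by
          intro x y hx hy hx0 hy0
          simp only [hD]
          refine if_neg ?_
          rintro (h | h | h)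
          · exact hx0 h
          · exact hy0 h
          · refine hI' ?_
            rw [hI, sqf_mem_span_sqf_iff]
            exact ⟨_, Or.inr h, Finset.insert_subset hx (Finset.singleton_subset_iff.2 hy)⟩
        rw [hno b c (by simp) (by simp) hb hc, hno a c (by simp) (by simp) ha hc,
          hno a b (by simp) (by simp) ha hb]
        ring
  have hall : ∀ a b c, D b c - D a c + D a b = 0 ∨
      (a ≠ b ∧ b ≠ c ∧ a ≠ c ∧ sqf K n {a, b, c} ∈ J) := by
    intro a b c
    rcases eq_or_ne a b with rfl | hab
    · left; rw [hDself]; ring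
    rcases eq_or_ne b c with rfl | hbc
    · left; rw [hDself]; ring
    rcases eq_or_ne a c with rfl | hac
    · left; rw [hDself, hDanti a b]; ring
    have hset1 : ({a, b, c} : Finset (Fin n)) = {b, a, c} := Finset.insert_comm _ _ _
    have hset2 : ({a, b, c} : Finset (Fin n)) = {a, c, b} := by rw [Finset.pair_comm]
    have hset3 : ({a, b, c} : Finset (Fin n)) = {b, c, a} := by ext; simp; tauto
    have hset4 : ({a, b, c} : Finset (Fin n)) = {c, a, b} := by ext; simp; tauto
    have hset5 : ({a, b, c} : Finset (Fin n)) = {c, b, a} := by ext; simp; tauto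
    rw [and_iff_right hab, and_iff_right hbc, and_iff_right hac]
    have e1 := hDanti a b
    have e2 := hDanti b c
    have e3 := hDanti a c
    rcases hab.lt_or_gt with h1 | h1 <;> rcases hbc.lt_or_gt with h2 | h2 <;>
      rcases hac.lt_or_gt with h3 | h3
    · exact hsorted a b c h1 h2
    · exact absurd (h1.trans h2) h3.not_gt
    · rw [hset2]
      refine (hsorted a c b h3 h2).imp (fun h => ?_) id
      linear_combination -h + e2
    · rw [hset4]
      refine (hsorted c a b h3 h1).imp (fun h => ?_) id
      linear_combination h + e2 - e3
    · rw [hset1]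
      refine (hsorted b a c h1 h3).imp (fun h => ?_) id
      linear_combination -h + e1
    · rw [hset3]
      refine (hsorted b c a h2 h3).imp (fun h => ?_) id
      linear_combination h + e1 - e3
    · exact absurd (h2.trans h1) h3.not_gt
    · rw [hset5]
      refine (hsorted c b a h2 h1).imp (fun h => ?_) id
      linear_combination -h + e1 + e2 - e3
  have hmI : ∀ a b, C (D a b) * (X a * X b) ∈ I := by
    intro a b
    by_cases h : a = 0 ∨ b = 0 ∨ ({a, b} : Finset (Fin n)) ∈ E
    · rcases eq_or_ne a b with rfl | hab
      · simp [hDself]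
      refine I.mul_mem_left _ ?_
      have : X a * X b = sqf K n {a, b} := by simp [sqf, Finset.prod_pair hab]
      rw [this, hI, sqf_mem_span_sqf_iff]
      rcases h with rfl | rfl | h
      · exact ⟨{0}, Or.inl rfl, by simp⟩
      · exact ⟨{0}, Or.inl rfl, by simp⟩
      · exact ⟨_, Or.inr h, subset_rfl⟩
    · simp only [hD, if_neg h]
      simp
  obtain ⟨c, hc⟩ := exists_smul_sub_smul_eq_of_koszul_two_cocycle hr hs ht hreg
    (m := fun a b => Submodule.Quotient.mk ⟨C (D a b) * (X a * X b), hmI a b⟩) (by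
    intro a b c
    rw [← Submodule.Quotient.mk_smul, ← Submodule.Quotient.mk_smul, ← Submodule.Quotient.mk_smul,
      ← Submodule.Quotient.mk_sub, ← Submodule.Quotient.mk_add, Submodule.Quotient.mk_eq_zero]
    change X a * (C (D b c) * (X b * X c)) - X b * (C (D a c) * (X a * X c)) +
      X c * (C (D a b) * (X a * X b)) ∈ J
    have : X a * (C (D b c) * (X b * X c)) - X b * (C (D a c) * (X a * X c)) +
        X c * (C (D a b) * (X a * X b)) =
        C (D b c - D a c + D a b) * (X a * (X b * X c)) := by
      rw [C_add, C_sub]; ring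
    rw [this]
    rcases hall a b c with h | ⟨hab, hbc, hac, h⟩
    · simp [h]
    · refine J.mul_mem_left _ ?_
      rwa [sqf, Finset.prod_insert (by simp [hab, hac]), Finset.prod_pair hbc] at h)
  choose N hN using fun a => Submodule.Quotient.mk_surjective _ (c a)
  have hwN : ∀ b, b ≠ 0 → sqf K n {0, b} ∉ J →
      w b = - coeff (Finsupp.single 0 1) (N 0 : MvPolynomial (Fin n) K) := by
    intro b hb hbJ
    have h := hc 0 b
    rw [← hN, ← hN, ← Submodule.Quotient.mk_smul, ← Submodule.Quotient.mk_smul,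
      ← Submodule.Quotient.mk_sub, Submodule.Quotient.eq] at h
    change C (D 0 b) * (X 0 * X b) - (X 0 * (N b : MvPolynomial (Fin n) K) - X b * (N 0 : MvPolynomial (Fin n) K)) ∈ J at h
    have hcoeff : coeff (Finsupp.single 0 1 + Finsupp.single b 1)
        (C (D 0 b) * (X 0 * X b) - (X 0 * (N b : MvPolynomial (Fin n) K) - X b * (N 0 : MvPolynomial (Fin n) K))) = 0 := by
      by_contra hne
      rw [hJ, mem_span_sqf_iff] at h
      obtain ⟨T, hT, hle⟩ := h _ (mem_support_iff.2 hne)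
      refine hbJ ?_
      rw [hJ, sqf_mem_span_sqf_iff]
      have : Finsupp.single 0 1 + Finsupp.single b 1 = sqfExp ({0, b} : Finset (Fin n)) := by
        rw [sqfExp, Finset.sum_pair hb.symm]
      rw [this, sqfExp_le_iff] at hle
      exact ⟨T, hT, hle⟩
    have hX : (X b : MvPolynomial (Fin n) K) = monomial (Finsupp.single b 1) 1 := rfl
    have hNb : coeff (Finsupp.single b 1) (N b : MvPolynomial (Fin n) K) = 0 :=
      coeff_single_eq_zero_of_mem hE (hI ▸ (N b).2) hb
    rw [coeff_sub, coeff_sub, coeff_C_mul, coeff_X_mul, coeff_X_mul, hNb,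
      add_comm (Finsupp.single 0 1), coeff_X_mul, hX, coeff_monomial, if_pos rfl] at hcoeff
    have hDb : D 0 b = w b := by simp [hD, hw0]
    rw [hDb] at hcoeff
    linear_combination hcoeff
  rw [hwN k hk0 hk, ← hwN i hi0 hi, hwi]

lemma SqfPartition.sdepth_mem {n : ℕ} {P : Set (Finset (Fin n))} (hP : P.Nonempty)
    (pt : SqfPartition n P) : ∃ p ∈ pt.intervals, p.2.card = pt.sdepth := by
  obtain ⟨T, hT⟩ := hP
  obtain ⟨p, hp, -⟩ := pt.covers T hT
  exact Nat.sInf_mem (s := {k | ∃ p ∈ pt.intervals, p.2.card = k}) ⟨_, p, hp, rfl⟩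

lemma le_stanleyDepth {n d : ℕ} {K : Type*} [Field K] {I J : Ideal (MvPolynomial (Fin n) K)}
    (hP : (sqfPoset K n I J).Nonempty) {pt : SqfPartition n (sqfPoset K n I J)}
    (hpt : ∀ p ∈ pt.intervals, d ≤ p.2.card) : d ≤ stanleyDepth K n I J := by
  obtain ⟨p, hp, hps⟩ := pt.sdepth_mem hP
  refine (hps ▸ hpt p hp).trans (le_csSup ⟨n, ?_⟩ ⟨pt, rfl⟩)
  rintro _ ⟨pt', rfl⟩
  obtain ⟨q, -, hq⟩ := pt'.sdepth_mem hP
  rw [← hq]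
  simpa using Finset.card_le_univ q.2

lemma Nat.sSup_mem_of_pos {s : Set ℕ} (h : 0 < sSup s) : sSup s ∈ s := by
  refine Nat.sSup_mem ?_ ?_
  · rw [Set.nonempty_iff_ne_empty]
    rintro rfl
    simp at h
  · by_contra hb
    rw [Nat.sSup_of_not_bddAbove hb] at h
    exact h.false

/-- **Lemma 1.8.** -/
theorem stmt2 (n : ℕ) [NeZero n] (K : Type*) [Field K]
    (I J : Ideal (MvPolynomial (Fin n) K))
    (E : Set (Finset (Fin n))) (hE : E.Nonempty)
    (hEdeg : ∀ T ∈ E, T.card = 2 ∧ (0 : Fin n) ∉ T)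
    (hI : I = Ideal.span ({X (0 : Fin n)} ∪ sqf K n '' E))
    (hJI : J < I)
    (hJ : ∃ G : Set (Finset (Fin n)), (∀ T ∈ G, 2 ≤ T.card) ∧
      J = Ideal.span (sqf K n '' G))
    (hsd : stanleyDepth K n I J = 2)
    (hEJ : ∀ T ∈ E, X (0 : Fin n) * sqf K n T ∉ J)
    (hout : ∀ T : Finset (Fin n), T.card = 2 → sqf K n T ∉ I →
      X (0 : Fin n) * sqf K n T ∈ J) :
    mdepth K n I J ≤ 2 := by
  classical
  obtain ⟨G, -, hJG⟩ := hJ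
  have hI' : I = Ideal.span (sqf K n '' insert {0} E) := by
    rw [hI, Set.image_insert_eq, X_eq_sqf, Set.insert_eq]
  have hJmono : ∀ {T U : Finset (Fin n)}, T ⊆ U → sqf K n T ∈ J → sqf K n U ∈ J := by
    intro T U hTU hT
    rw [hJG, sqf_mem_span_sqf_iff] at hT ⊢
    obtain ⟨g, hg, hgT⟩ := hT
    exact ⟨g, hg, hgT.trans hTU⟩
  have hzeroI : ∀ {T : Finset (Fin n)}, 0 ∈ T → sqf K n T ∈ I := fun hT => by
    rw [hI', sqf_mem_span_sqf_iff]
    exact ⟨{0}, Or.inl rfl, by simpa using hT⟩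
  have hEJ' : ∀ T ∈ E, sqf K n (insert 0 T) ∉ J := fun T hT => by
    rw [← X_mul_sqf K (hEdeg T hT).2]
    exact hEJ T hT
  have hIcases : ∀ {T : Finset (Fin n)}, sqf K n T ∈ I → 0 ∈ T ∨ ∃ a ∈ E, a ⊆ T := by
    intro T hT
    rw [hI', sqf_mem_span_sqf_iff] at hT
    obtain ⟨a, rfl | ha, hsub⟩ := hT
    · exact Or.inl (by simpa using hsub)
    · exact Or.inr ⟨a, ha, hsub⟩
  by_contra hdepth
  rw [not_le] at hdepth
  obtain ⟨rs, hlen, hrs, hreg⟩ := Nat.sSup_mem_of_pos (lt_of_le_of_lt (Nat.zero_le _) hdepth)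
  rw [mdepth, ← hlen] at hdepth
  obtain ⟨r, s, t, hr, hs, ht, hreg3⟩ : ∃ r s t : MvPolynomial (Fin n) K,
      r ∈ Ideal.span (Set.range X) ∧ s ∈ Ideal.span (Set.range X) ∧
      t ∈ Ideal.span (Set.range X) ∧
      RingTheory.Sequence.IsWeaklyRegular (quotMod K n I J) [r, s, t] := by
    have hreg' := hreg.toIsWeaklyRegular
    match rs, hdepth, hrs, hreg' with
    | r :: s :: t :: _, _, hrs, hreg' =>
      refine ⟨r, s, t, hrs r (by simp), hrs s (by simp), hrs t (by simp), ?_⟩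
      simp only [RingTheory.Sequence.isWeaklyRegular_cons_iff] at hreg' ⊢
      exact ⟨hreg'.1, hreg'.2.1, hreg'.2.2.1, RingTheory.Sequence.IsWeaklyRegular.nil _ _⟩
  obtain ⟨e, he⟩ := hE
  obtain ⟨i, i', hii', rfl⟩ := Finset.card_eq_two.1 (hEdeg e he).1
  set V : Set (Fin n) := {k | k ≠ 0 ∧ sqf K n {0, k} ∉ J} with hV
  have hEV : ∀ a ∈ E, ∀ k ∈ a, k ∈ V := by
    refine fun a ha k hk => ⟨fun h => (hEdeg a ha).2 (h ▸ hk), fun h => hEJ' a ha (hJmono ?_ h)⟩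
    exact Finset.insert_subset_insert _ (Finset.singleton_subset_iff.2 hk)
  have hiV : i ∈ V := hEV _ he i (by simp)
  obtain ⟨j, f, t', hf, ht', hfj, hft⟩ := exists_matching_of_coboundary_injective (K := K)
    (C := {c | 0 ∉ c ∧ c ∈ sqfPoset K n I J ∧ c.card = 3}) hEV
    ⟨i', hEV _ he i' (by simp), hii'.symm⟩ (fun w hwV hwi hker => by
      ext k
      by_cases hkV : k ∈ V
      · exact eq_zero_of_isWeaklyRegular hEdeg hI' hJG hout hr hs ht hreg3 (hwV 0 (by simp [hV]))
          hiV.1 hiV.2 hwi hker hkV.1 hkV.2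
      · exact hwV k hkV)
  have hf0 : ∀ k, 0 ∉ f k := fun k => (hEdeg _ (hft k).1).2
  have ht0 : ∀ k, 0 ∉ t' k := fun k => (hft k).2.2.1.1
  set Φ : Finset (Fin n) → Finset (Fin n) := fun T =>
    if h : ∃ k : {k // k ∈ V ∧ k ≠ i}, T = {0, ↑k} then insert 0 (f h.choose)
    else if h : ∃ k, T = f k then t' h.choose else insert 0 T with hΦ
  have hpair : ∀ {k l : Fin n}, k ≠ 0 → ({0, k} : Finset (Fin n)) = {0, l} → k = l := by
    intro k l hk h
    have : k ∈ ({0, l} : Finset (Fin n)) := h ▸ by simp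
    simpa [hk] using this
  have hΦvertex : ∀ k : {k // k ∈ V ∧ k ≠ i}, Φ {0, ↑k} = insert 0 (f k) := by
    intro k
    have h : ∃ l : {k // k ∈ V ∧ k ≠ i}, ({0, ↑k} : Finset (Fin n)) = {0, ↑l} := ⟨k, rfl⟩
    simp only [hΦ]
    rw [dif_pos h, ← Subtype.ext (hpair k.2.1.1 h.choose_spec)]
  have hΦf : ∀ k, Φ (f k) = t' k := by
    intro k
    have h : ¬ ∃ l : {k // k ∈ V ∧ k ≠ i}, f k = {0, ↑l} := by
      rintro ⟨l, hl⟩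
      exact hf0 k (by simp [hl])
    have h' : ∃ l, f k = f l := ⟨k, rfl⟩
    simp only [hΦ]
    rw [dif_neg h, dif_pos h', ← hf h'.choose_spec]
  have hΦE : ∀ T ∈ E, (∀ k, T ≠ f k) → Φ T = insert 0 T := by
    intro T hT hTf
    have h : ¬ ∃ l : {k // k ∈ V ∧ k ≠ i}, T = {0, ↑l} := by
      rintro ⟨l, rfl⟩
      exact (hEdeg _ hT).2 (by simp)
    simp only [hΦ]
    rw [dif_neg h, dif_neg (by simpa using hTf)]
  have hclass : ∀ T ∈ sqfPoset K n I J, T.card = 2 → T ≠ {0, i} → T ≠ {0, ↑j} →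
      (∃ k, k ≠ j ∧ T = {0, ↑k}) ∨ (∃ k, T = f k) ∨ (T ∈ E ∧ ∀ k, T ≠ f k) := by
    intro T hT h2 hTi hTj
    rcases hIcases hT.1 with h0 | ⟨a, ha, haT⟩
    · obtain ⟨x, hx⟩ := Finset.card_eq_one.1 (by
        rw [Finset.card_erase_of_mem h0, h2] : (T.erase 0).card = 1)
      have hTx : T = {0, x} := by rw [← hx, Finset.insert_erase h0]
      have hx0 : x ≠ 0 := by
        rintro rfl
        simp [hTx] at h2
      have hxV : x ∈ V := ⟨hx0, hTx ▸ hT.2⟩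
      refine Or.inl ⟨⟨x, hxV, ?_⟩, ?_, hTx⟩
      · rintro rfl
        exact hTi hTx
      · intro h
        exact hTj (by rw [hTx, ← h])
    · obtain rfl := Finset.eq_of_subset_of_card_le haT (by rw [h2, (hEdeg a ha).1])
      by_cases h : ∃ k, a = f k
      · exact Or.inr (Or.inl h)
      · exact Or.inr (Or.inr ⟨ha, by simpa using h⟩)
  have hins : ∀ {T U : Finset (Fin n)}, 0 ∉ T → 0 ∉ U → insert 0 T = insert 0 U → T = U := by
    intro T U hT hU h
    rw [← Finset.erase_insert hT, h, Finset.erase_insert hU]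
  have hv0 : insert 0 (f j) = {0, i, ↑j} := by rw [hfj]
  have hEP : ∀ T ∈ E, insert 0 T ∈ sqfPoset K n I J := fun T hT =>
    ⟨hzeroI (by simp), hEJ' T hT⟩
  have hEcard : ∀ T ∈ E, (insert 0 T).card = 3 := fun T hT => by
    rw [Finset.card_insert_of_notMem (hEdeg T hT).2, (hEdeg T hT).1]
  obtain ⟨pt, hpt⟩ := exists_sqfPartition_of_matching (P := sqfPoset K n I J) (o := 0) (i := i)
    (j := ↑j) hiV.1.symm j.2.1.1.symm j.2.2.symm (by
      intro T hT
      rcases hIcases hT.1 with h0 | ⟨a, ha, haT⟩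
      · rcases Nat.lt_or_ge T.card 2 with h | h
        · left
          exact (Finset.eq_of_subset_of_card_le (Finset.singleton_subset_iff.2 h0)
            (by rw [Finset.card_singleton]; omega)).symm
        · exact Or.inr h
      · exact Or.inr ((hEdeg a ha).1 ▸ Finset.card_le_card haT))
    ⟨hzeroI (by simp), fun h => hEJ' _ he (hJmono (by simp) h)⟩
    (hv0 ▸ hEP _ (hft j).1) Φ (by
      intro T hT h2 hTi hTj
      rcases hclass T hT h2 hTi hTj with ⟨k, hkj, rfl⟩ | ⟨k, rfl⟩ | ⟨hTE, hTf⟩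
      · rw [hΦvertex, ← hv0]
        refine ⟨Finset.insert_subset_insert _ (Finset.singleton_subset_iff.2 (hft k).2.1),
          hEcard _ (hft k).1, hEP _ (hft k).1, fun h => hkj (hf (hins (hf0 k) (hf0 j) h))⟩
      · rw [hΦf]
        obtain ⟨-, -, ⟨h0, hP, h3⟩, hsub⟩ := hft k
        exact ⟨hsub, h3, hP, fun h => h0 (by simp [h])⟩
      · rw [hΦE T hTE hTf, ← hv0]
        exact ⟨Finset.subset_insert _ _, hEcard T hTE, hEP T hTE,
          fun h => hTf j (hins (hEdeg T hTE).2 (hf0 j) h)⟩) (by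
      intro T hT h2 hTi hTj U hU h2' hUi hUj hTU
      rcases hclass T hT h2 hTi hTj with ⟨k, hkj, rfl⟩ | ⟨k, rfl⟩ | ⟨hTE, hTf⟩ <;>
        rcases hclass U hU h2' hUi hUj with ⟨l, hlj, rfl⟩ | ⟨l, rfl⟩ | ⟨hUE, hUf⟩
      · rw [hΦvertex, hΦvertex] at hTU
        rw [hf (hins (hf0 k) (hf0 l) hTU)]
      · rw [hΦvertex, hΦf] at hTU
        exact absurd (hTU ▸ Finset.mem_insert_self _ _) (ht0 l)
      · rw [hΦvertex, hΦE U hUE hUf] at hTU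
        exact absurd (hins (hf0 k) (hEdeg U hUE).2 hTU).symm (hUf k)
      · rw [hΦvertex, hΦf] at hTU
        exact absurd (hTU ▸ Finset.mem_insert_self _ _) (ht0 k)
      · rw [hΦf, hΦf] at hTU
        rw [ht' hTU]
      · rw [hΦf, hΦE U hUE hUf] at hTU
        exact absurd (hTU ▸ Finset.mem_insert_self _ _) (ht0 k)
      · rw [hΦvertex, hΦE T hTE hTf] at hTU
        exact absurd (hins (hEdeg T hTE).2 (hf0 l) hTU) (hTf l)
      · rw [hΦf, hΦE T hTE hTf] at hTU
        exact absurd (hTU ▸ Finset.mem_insert_self _ _) (ht0 l)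
      · rw [hΦE T hTE hTf, hΦE U hUE hUf] at hTU
        exact hins (hEdeg T hTE).2 (hEdeg U hUE).2 hTU)
  have := le_stanleyDepth ⟨_, hEP _ he⟩ hpt
  omega
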